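/- Let M be a countable set and G ≤ Sym(M) a permutation group with no algebraicity such that for every a ∈ M the stabilizer G_a is a boundedly maximal subgroup of G. Let Ω = [0,1]^M carry the product σ-algebra and the shift action, and let μ be a G-invariant, ergodic Borel probability measure on Ω. Then μ is a product measure: μ = ⊗_{a∈M} λ_a, where λ_a is the distribution of the coordinate ξ_a under μ. -/

import Mathlib

open MeasureTheory ProbabilityTheory

/-- The shift action of a permutation `g` of `M` on configurations `ω : M → [0,1]`:
`(g · ω)(a) = ω (g⁻¹ a)`. -/
def shiftAct {M : Type*} (g : Equiv.Perm M) (ω : M → unitInterval) : M → unitInterval :=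
  fun a => ω (g⁻¹ a)

/-- The stabilizer `G_a` is *boundedly maximal* in `G`: there is `d` such that for every
`g ∉ G_a`, every element of `G` is a word of length at most `d` in `g`, `g⁻¹`, and elements
of `G_a`. -/
def BoundedlyMaximalStabilizer {M : Type*} (G : Subgroup (Equiv.Perm M)) (a : M) : Prop :=
  ∃ d : ℕ, ∀ g : G, g ∉ MulAction.stabilizer G a → ∀ h : G,
    ∃ l : List G, l.length ≤ d ∧
      (∀ x ∈ l, x = g ∨ x = g⁻¹ ∨ x ∈ MulAction.stabilizer G a) ∧ h = l.prod

open Function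

section Shift

variable {M : Type*}

theorem shiftAct_mul (g h : Equiv.Perm M) (ω : M → unitInterval) :
    shiftAct (g * h) ω = shiftAct g (shiftAct h ω) := by
  funext a
  simp [shiftAct]

theorem shiftAct_one (ω : M → unitInterval) : shiftAct 1 ω = ω := by
  funext a
  simp [shiftAct]

theorem measurable_shiftAct (g : Equiv.Perm M) :
    Measurable (shiftAct g : (M → unitInterval) → M → unitInterval) :=
  measurable_pi_lambda _ fun a => measurable_pi_apply (g⁻¹ a)

theorem shiftAct_preimage_mul (g h : Equiv.Perm M) (E : Set (M → unitInterval)) :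
    shiftAct (g * h) ⁻¹' E = shiftAct h ⁻¹' (shiftAct g ⁻¹' E) := by
  ext ω
  simp [shiftAct_mul]

/-- The measure of the displacement of `E` under the shift by `g`. -/
noncomputable def displacement (μ : Measure (M → unitInterval)) (E : Set (M → unitInterval))
    (g : Equiv.Perm M) : ENNReal :=
  μ (symmDiff (shiftAct g ⁻¹' E) E)

variable {μ : Measure (M → unitInterval)} {E F : Set (M → unitInterval)} {g h : Equiv.Perm M}

theorem measure_symmDiff_shiftAct_preimage (hg : μ.map (shiftAct g) = μ)
    (hE : MeasurableSet E) (hF : MeasurableSet F) :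
    μ (symmDiff (shiftAct g ⁻¹' E) (shiftAct g ⁻¹' F)) = μ (symmDiff E F) := by
  rw [← Set.preimage_symmDiff, ← Measure.map_apply (measurable_shiftAct g) (hE.symmDiff hF), hg]

theorem displacement_one : displacement μ E 1 = 0 := by
  have : shiftAct (1 : Equiv.Perm M) ⁻¹' E = E := by
    ext ω
    simp [shiftAct_one]
  simp [displacement, this]

theorem displacement_mul_le (hh : μ.map (shiftAct h) = μ) (hE : MeasurableSet E) :
    displacement μ E (g * h) ≤ displacement μ E g + displacement μ E h := by
  rw [displacement, shiftAct_preimage_mul]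
  refine (measure_symmDiff_le _ (shiftAct h ⁻¹' E) _).trans ?_
  rw [measure_symmDiff_shiftAct_preimage hh (measurable_shiftAct g hE) hE]
  rfl

theorem displacement_inv (hg : μ.map (shiftAct g) = μ) (hE : MeasurableSet E) :
    displacement μ E g⁻¹ = displacement μ E g := by
  rw [displacement, ← measure_symmDiff_shiftAct_preimage hg (measurable_shiftAct _ hE) hE,
    ← shiftAct_preimage_mul, inv_mul_cancel, symmDiff_comm, displacement]
  congr 2

theorem displacement_list_prod_le {G : Subgroup (Equiv.Perm M)}
    (hinv : ∀ g ∈ G, μ.map (shiftAct g) = μ) (hE : MeasurableSet E) {δ : ENNReal}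
    (l : List G) (hl : ∀ x ∈ l, displacement μ E x ≤ δ) :
    displacement μ E (l.prod : G) ≤ l.length * δ := by
  induction l with
  | nil => simp [displacement_one]
  | cons x l ih =>
    rw [List.prod_cons, Subgroup.coe_mul, List.length_cons, Nat.cast_succ, add_mul, one_mul,
      add_comm]
    refine (displacement_mul_le (hinv _ l.prod.2) hE).trans ?_
    exact add_le_add (hl x (by simp)) (ih fun y hy => hl y (by simp [hy]))

theorem displacement_le_of_approx [IsFiniteMeasure μ] (hg : μ.map (shiftAct g) = μ)
    (hE : MeasurableSet E) (hF : MeasurableSet F) (hgF : shiftAct g ⁻¹' F = F) :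
    displacement μ E g ≤ 2 * μ (symmDiff F E) := by
  refine (measure_symmDiff_le _ F _).trans ?_
  rw [two_mul]
  refine add_le_add (le_of_eq ?_) le_rfl
  conv_lhs => rw [← hgF]
  rw [measure_symmDiff_shiftAct_preimage hg hE hF, symmDiff_comm]

/-- The σ-algebra generated by the coordinates other than `a`. -/
abbrev otherCoords (a : M) : MeasurableSpace (M → unitInterval) :=
  MeasurableSpace.comap (fun ω (b : {b : M // b ≠ a}) => ω b) MeasurableSpace.pi

theorem otherCoords_le (a : M) : otherCoords a ≤ MeasurableSpace.pi :=
  Measurable.comap_le (measurable_pi_lambda _ fun b => measurable_pi_apply b.1)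

theorem measurable_apply_otherCoords {a b : M} (hb : b ≠ a) :
    Measurable[otherCoords a] fun ω : M → unitInterval => ω b :=
  (measurable_pi_apply (X := fun _ : {b : M // b ≠ a} => unitInterval) ⟨b, hb⟩).comp
    (comap_measurable _)

theorem measurable_shiftAct_otherCoords {a : M} (ha : g a = a) :
    Measurable[otherCoords a, otherCoords a]
      (shiftAct g : (M → unitInterval) → M → unitInterval) := by
  refine measurable_comap_iff.2 (@measurable_pi_lambda _ _ _ (otherCoords a) _ _ fun b => ?_)
  refine measurable_apply_otherCoords (b := g⁻¹ b) fun hb => b.2 ?_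
  rwa [Equiv.Perm.inv_eq_iff_eq, ha] at hb

theorem exists_cylinder_approx [IsFiniteMeasure μ] {a : M} (hE : MeasurableSet[otherCoords a] E)
    {ε : ENNReal} (hε : 0 < ε) :
    ∃ (A : Finset M) (F : Set (M → unitInterval)), a ∉ A ∧ MeasurableSet F ∧
      (∀ g : Equiv.Perm M, (∀ b ∈ A, g b = b) → shiftAct g ⁻¹' F = F) ∧
      μ (symmDiff F E) < ε := by
  classical
  obtain ⟨C, hC, rfl⟩ := hE
  have hr : Measurable fun (ω : M → unitInterval) (b : {b : M // b ≠ a}) => ω b :=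
    measurable_pi_lambda _ fun b => measurable_pi_apply b.1
  obtain ⟨t, ht, htC⟩ := exists_measure_symmDiff_lt_of_generateFrom_isSetRing
    (μ := μ.map fun ω (b : {b : M // b ≠ a}) => ω b)
    (isSetRing_measurableCylinders (α := fun _ : {b : M // b ≠ a} => unitInterval))
    ⟨{Set.univ}, Set.countable_singleton _, by
      simpa using univ_mem_measurableCylinders fun _ : {b : M // b ≠ a} => unitInterval, by simp⟩
    generateFrom_measurableCylinders.symm hC hε
  obtain ⟨s, S, hS, rfl⟩ := (mem_measurableCylinders t).1 ht
  refine ⟨s.map (Embedding.subtype _), _, by simp, hr hS.cylinder, ?_, ?_⟩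
  · intro g hg
    ext ω
    have : s.restrict (fun b : {b : M // b ≠ a} => shiftAct g ω b)
        = s.restrict (fun b : {b : M // b ≠ a} => ω b) := by
      funext b
      have hb : g b.1.1 = b.1.1 := hg _ (Finset.mem_map_of_mem _ b.2)
      simp only [Finset.restrict, shiftAct]
      congr 1
      rw [Equiv.Perm.inv_eq_iff_eq, hb]
    simp only [Set.mem_preimage, mem_cylinder, this]
  · rwa [Measure.map_apply hr (hS.cylinder.symmDiff hC), Set.preimage_symmDiff] at htC

/-- If all finite pointwise stabilizers of sets omitting `a` move `a` and `G_a` is boundedly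
maximal, then a `G_a`-invariant event depending only on the other coordinates is
`G`-invariant. -/
theorem displacement_eq_zero_of_otherCoords [IsFiniteMeasure μ] {G : Subgroup (Equiv.Perm M)}
    {a : M} (hmove : ∀ A : Finset M, a ∉ A → ∃ g ∈ G, (∀ b ∈ A, g b = b) ∧ g a ≠ a)
    (hbm : BoundedlyMaximalStabilizer G a) (hinv : ∀ g ∈ G, μ.map (shiftAct g) = μ)
    (hE : MeasurableSet[otherCoords a] E)
    (hfix : ∀ g ∈ G, g a = a → displacement μ E g = 0) (hh : h ∈ G) :
    displacement μ E h = 0 := by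
  obtain ⟨d, hd⟩ := hbm
  have hE' : MeasurableSet E := otherCoords_le a E hE
  have key : ∀ ε : ENNReal, 0 < ε → displacement μ E h ≤ d * (2 * ε) := by
    intro ε hε
    obtain ⟨A, F, haA, hF, hAF, hFE⟩ := exists_cylinder_approx (μ := μ) hE hε
    obtain ⟨g, hgG, hgA, hga⟩ := hmove A haA
    have hgE : displacement μ E g ≤ 2 * ε :=
      (displacement_le_of_approx (hinv g hgG) hE' hF (hAF g hgA)).trans (by gcongr)
    obtain ⟨l, hld, hl, hprod⟩ := hd ⟨g, hgG⟩ (fun hmem => hga hmem) ⟨h, hh⟩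
    have := displacement_list_prod_le hinv hE' (δ := 2 * ε) l fun x hx => by
      rcases hl x hx with rfl | rfl | hx
      · exact hgE
      · simpa [displacement_inv (hinv g hgG) hE'] using hgE
      · simp [hfix x x.2 hx]
    rw [← hprod] at this
    exact this.trans (by gcongr)
  refine le_antisymm (ENNReal.le_of_forall_pos_le_add fun ε hε _ => ?_) zero_le
  have hpos : (0 : ENNReal) < ε / (d * 2 + 1) :=
    ENNReal.div_pos (by simpa using hε.ne') (by finiteness)
  refine (key _ hpos).trans ?_
  rw [zero_add, ← mul_assoc]
  calc (d * 2 : ENNReal) * (ε / (d * 2 + 1)) ≤ (d * 2 + 1) * (ε / (d * 2 + 1)) := by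
        gcongr
        exact le_self_add
    _ ≤ ε := ENNReal.mul_div_le

theorem condExp_comp_shiftAct_ae_eq [IsFiniteMeasure μ] {a : M} (ha : g a = a)
    (hg : μ.map (shiftAct g) = μ) {f : (M → unitInterval) → ℝ} (hf : Integrable f μ)
    (hfg : f ∘ shiftAct g = f) :
    μ[f | otherCoords a] ∘ shiftAct g =ᵐ[μ] μ[f | otherCoords a] := by
  have hmp : MeasurePreserving (shiftAct g) μ μ := ⟨measurable_shiftAct g, hg⟩
  have hgi : g⁻¹ a = a := by rw [Equiv.Perm.inv_eq_iff_eq, ha]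
  refine ae_eq_condExp_of_forall_setIntegral_eq (otherCoords_le a) hf
    (fun s _ _ => (hmp.integrable_comp_of_integrable integrable_condExp).integrableOn) ?_
    (stronglyMeasurable_condExp.comp_measurable
      (measurable_shiftAct_otherCoords ha)).aestronglyMeasurable
  intro s hs _
  have hs' : MeasurableSet[otherCoords a] (shiftAct g⁻¹ ⁻¹' s) :=
    measurable_shiftAct_otherCoords hgi hs
  have hss : shiftAct g ⁻¹' (shiftAct g⁻¹ ⁻¹' s) = s := by
    rw [← shiftAct_preimage_mul]
    ext ω
    simp [shiftAct_one]
  have hcv : ∀ u : (M → unitInterval) → ℝ, Integrable u μ →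
      ∫ x in s, (u ∘ shiftAct g) x ∂μ = ∫ x in shiftAct g⁻¹ ⁻¹' s, u x ∂μ := by
    intro u hu
    conv_rhs => rw [← hg]
    rw [setIntegral_map (otherCoords_le a _ hs') (by rw [hg]; exact hu.aestronglyMeasurable)
      hmp.aemeasurable, hss]
    rfl
  rw [hcv _ integrable_condExp, setIntegral_condExp (otherCoords_le a) hf hs', ← hcv f hf, hfg]

/-- The coordinate at `a` is independent of all the other coordinates. -/
theorem measure_inter_otherCoords [IsProbabilityMeasure μ] {G : Subgroup (Equiv.Perm M)}
    {a : M} (hmove : ∀ A : Finset M, a ∉ A → ∃ g ∈ G, (∀ b ∈ A, g b = b) ∧ g a ≠ a)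
    (hbm : BoundedlyMaximalStabilizer G a) (hinv : ∀ g ∈ G, μ.map (shiftAct g) = μ)
    (herg : ∀ E : Set (M → unitInterval), MeasurableSet E →
      (∀ g ∈ G, μ (symmDiff (shiftAct g ⁻¹' E) E) = 0) → μ E = 0 ∨ μ E = 1)
    {s : Set unitInterval} (hs : MeasurableSet s) (hE : MeasurableSet[otherCoords a] E) :
    μ ((fun ω => ω a) ⁻¹' s ∩ E) = μ ((fun ω => ω a) ⁻¹' s) * μ E := by
  set B : Set (M → unitInterval) := (fun ω => ω a) ⁻¹' s with hB
  have hBm : MeasurableSet B := measurable_pi_apply a hs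
  set f : (M → unitInterval) → ℝ := B.indicator 1 with hf
  have hfi : Integrable f μ := (integrable_const 1).indicator hBm
  have hfE : ∀ F, MeasurableSet F → ∫ x in F, f x ∂μ = μ.real (B ∩ F) := by
    intro F hF
    rw [hf, integral_indicator_one hBm, measureReal_restrict_apply hBm]
  obtain ⟨c, hc⟩ : ∃ c, μ[f | otherCoords a] =ᵐ[μ] const _ c := by
    refine Filter.exists_eventuallyEq_const_of_forall_separating MeasurableSet fun U hU => ?_
    have hU' : MeasurableSet[otherCoords a] (μ[f | otherCoords a] ⁻¹' U) :=
      stronglyMeasurable_condExp.measurable hU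
    have hU'' := otherCoords_le a _ hU'
    have hfix : ∀ g ∈ G, g a = a → displacement μ (μ[f | otherCoords a] ⁻¹' U) g = 0 := by
      intro g hg hga
      refine measure_symmDiff_eq_zero_iff.2 ?_
      have hgi : g⁻¹ a = a := by rw [Equiv.Perm.inv_eq_iff_eq, hga]
      have hfg : f ∘ shiftAct g = f := by
        funext ω
        have hmem : shiftAct g ω ∈ B ↔ ω ∈ B := by
          simp only [hB, Set.mem_preimage, shiftAct, hgi]
        by_cases hω : ω ∈ B <;> simp [hf, hmem, hω]
      have := condExp_comp_shiftAct_ae_eq hga (hinv g hg) hfi hfg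
      exact (this.mono fun x hx => by
        simp only [Set.mem_preimage, ← hx, comp_apply]).set_eq
    rcases herg _ hU'' fun g hg =>
      displacement_eq_zero_of_otherCoords hmove hbm hinv hU' hfix hg with h0 | h1
    · exact Or.inr (measure_eq_zero_iff_ae_notMem.1 h0)
    · exact Or.inl ((mem_ae_iff_prob_eq_one hU'').2 h1)
  have hint : ∀ F, MeasurableSet[otherCoords a] F → μ.real (B ∩ F) = μ.real F * c := by
    intro F hF
    rw [← hfE F (otherCoords_le a _ hF), ← setIntegral_condExp (otherCoords_le a) hfi hF,
      integral_congr_ae (ae_restrict_of_ae hc)]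
    simp
  have hcB : μ.real B = c := by simpa using hint Set.univ MeasurableSet.univ
  rw [← ENNReal.toReal_eq_toReal_iff' (by finiteness) (by finiteness), ENNReal.toReal_mul]
  exact (hint E hE).trans (by rw [← hcB, mul_comm]; rfl)

end Shift

/-- a de Finetti theorem. If `G ≤ Sym(M)` has no algebraicity and all point
stabilizers are boundedly maximal subgroups, then every `G`-invariant ergodic probability
measure on `[0,1]^M` is the product of the marginal distributions of the coordinates. -/
theorem ergodic_invariant_measure_eq_product_of_boundedly_maximal
    {M : Type*} [Countable M] (G : Subgroup (Equiv.Perm M))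
    (hnoalg : ∀ A : Set M, A.Finite → ∀ b ∉ A,
      {c : M | ∃ g ∈ G, (∀ a ∈ A, g a = a) ∧ g b = c}.Infinite)
    (hbm : ∀ a : M, BoundedlyMaximalStabilizer G a)
    (μ : Measure (M → unitInterval)) [IsProbabilityMeasure μ]
    (hinv : ∀ g ∈ G, μ.map (shiftAct g) = μ)
    (herg : ∀ E : Set (M → unitInterval), MeasurableSet E →
      (∀ g ∈ G, μ (symmDiff (shiftAct g ⁻¹' E) E) = 0) → μ E = 0 ∨ μ E = 1) :
    ∀ (S : Finset M) (s : M → Set unitInterval), (∀ a ∈ S, MeasurableSet (s a)) →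
      μ {ω : M → unitInterval | ∀ a ∈ S, ω a ∈ s a}
        = ∏ a ∈ S, (μ.map (fun ω : M → unitInterval => ω a)) (s a) := by
  classical
  intro S s
  induction S using Finset.induction_on with
  | empty => simp
  | insert a S haS ih =>
    intro hs
    have hmove : ∀ A : Finset M, a ∉ A → ∃ g ∈ G, (∀ b ∈ A, g b = b) ∧ g a ≠ a := by
      intro A haA
      obtain ⟨c, ⟨g, hgG, hgA, hgc⟩, hca⟩ :=
        (hnoalg A A.finite_toSet a (by simpa using haA)).exists_notMem_finset {a}
      exact ⟨g, hgG, hgA, fun h => hca (by simp [← hgc, h])⟩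
    have hE : MeasurableSet[otherCoords a] {ω : M → unitInterval | ∀ b ∈ S, ω b ∈ s b} := by
      have : {ω : M → unitInterval | ∀ b ∈ S, ω b ∈ s b}
          = ⋂ b ∈ S, (fun ω : M → unitInterval => ω b) ⁻¹' s b := by
        ext ω
        simp
      rw [this]
      refine Finset.measurableSet_biInter S fun b hb => ?_
      exact measurable_apply_otherCoords (ne_of_mem_of_not_mem hb haS)
        (hs b (Finset.mem_insert_of_mem hb))
    have hsplit : {ω : M → unitInterval | ∀ b ∈ insert a S, ω b ∈ s b}
        = (fun ω => ω a) ⁻¹' s a ∩ {ω : M → unitInterval | ∀ b ∈ S, ω b ∈ s b} := by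
      ext ω
      simp
    rw [hsplit, measure_inter_otherCoords hmove (hbm a) hinv herg
      (hs a (Finset.mem_insert_self a S)) hE, Finset.prod_insert haS,
      Measure.map_apply (measurable_pi_apply a) (hs a (Finset.mem_insert_self a S)),
      ih fun b hb => hs b (Finset.mem_insert_of_mem hb)]
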